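/- Let G be a position with c(G) < −1 such that either θ(G) ≥ 2, or θ(G) = 1 and size(G) ≢ 3 (mod 4). Then opening a 3-chain is optimal, and v(G) = 1 if size(G) is odd and v(G) = 2 if size(G) is even. -/

import Mathlib

namespace DotsAndBoxes

/-- A component of a Dots & Boxes endgame position: an `n`-chain or an `n`-loop. -/
inductive Component : Type where
  | chain (n : ℕ)
  | loop (n : ℕ)
deriving DecidableEq

namespace Component

/-- The number of boxes in a component. -/
def size : Component → ℕ
  | chain n => n
  | loop n => n

def isChain : Component → Bool
  | chain _ => true
  | loop _ => false

def isLoop : Component → Bool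
  | chain _ => false
  | loop _ => true

/-- A chain must have length at least 3; a loop must have even length at least 4. -/
def Valid : Component → Prop
  | chain n => 3 ≤ n
  | loop n => 4 ≤ n ∧ Even n

end Component

/-- A position is a finite multiset of components. -/
abbrev Position := Multiset Component

def Position.Valid (G : Position) : Prop := ∀ C ∈ G, C.Valid

/-- The number of unclaimed boxes in a position. -/
def size (G : Position) : ℕ := (G.map Component.size).sum

/-- The number of chains of a position. -/
def numChains (G : Position) : ℕ := Multiset.card (G.filter fun C => C.isChain = true)

/-- The number of loops of a position. -/
def numLoops (G : Position) : ℕ := Multiset.card (G.filter fun C => C.isLoop = true)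

/-- θ(G), the number of 3-chains. -/
def theta (G : Position) : ℕ := G.count (Component.chain 3)

/-- f(G), the number of 4-loops. -/
def numF (G : Position) : ℕ := G.count (Component.loop 4)

/-- s(G), the number of 6-loops. -/
def numS (G : Position) : ℕ := G.count (Component.loop 6)

open Classical in
/-- The terminal bonus tb(G). -/
noncomputable def tb (G : Position) : ℤ :=
  if G = 0 then 0
  else if ∀ C ∈ G, C.isLoop = true then 8
  else if (∃ C ∈ G, C.isLoop = true) ∧ Component.chain 3 ∈ G ∧
      (∀ C ∈ G, C.isChain = true → C = Component.chain 3) then 6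
  else 4

/-- The controlled value c(G). -/
noncomputable def cval (G : Position) : ℤ :=
  (size G : ℤ) - 4 * (numChains G : ℤ) - 8 * (numLoops G : ℤ) + tb G

/-- The score v(G;C) of opening component `C`, given that the remainder of the
position has value `w`. -/
def openVal (C : Component) (w : ℤ) : ℤ :=
  match C with
  | Component.chain n => ((n : ℤ) - 2) + |w - 2|
  | Component.loop n => ((n : ℤ) - 4) + |w - 4|

/-- Auxiliary recursion (on the number of components) for the value `v`. -/
noncomputable def valueAux : ℕ → Position → ℤ
  | 0, _ => 0
  | n + 1, G =>
    if G = 0 then 0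
    else sInf { x : ℤ | ∃ C ∈ G, x = openVal C (valueAux n (G.erase C)) }

/-- The value v(G): v(∅) = 0, and v(G) = min over components C of G of v(G;C). -/
noncomputable def value (G : Position) : ℤ := valueAux (Multiset.card G) G

/-- v(G;C), the value of G given that the opener has just opened C. -/
noncomputable def valueOpen (G : Position) (C : Component) : ℤ :=
  openVal C (value (G.erase C))

/-- Opening a component C of G is optimal if C ∈ G and v(G;C) = v(G). -/
def Optimal (G : Position) (C : Component) : Prop :=
  C ∈ G ∧ valueOpen G C = value G


section Aux

open Component

/-- The position has a loop. -/
def HasL (G : Position) : Prop := ∃ n, loop n ∈ G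

/-- The position has a chain other than a 3-chain. -/
def HasD (G : Position) : Prop := ∃ n, n ≠ 3 ∧ chain n ∈ G

lemma hasL_zero : ¬ HasL 0 := by simp [HasL]
lemma hasD_zero : ¬ HasD 0 := by simp [HasD]
lemma hasL_chain (n : ℕ) (H : Position) : HasL (chain n ::ₘ H) ↔ HasL H := by simp [HasL]
lemma hasL_loop (n : ℕ) (H : Position) : HasL (loop n ::ₘ H) := ⟨n, by simp⟩
lemma hasD_loop (n : ℕ) (H : Position) : HasD (loop n ::ₘ H) ↔ HasD H := by simp [HasD]
lemma hasD_chain (n : ℕ) (H : Position) : HasD (chain n ::ₘ H) ↔ n ≠ 3 ∨ HasD H := by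
  simp only [HasD, Multiset.mem_cons, Component.chain.injEq]
  constructor
  · rintro ⟨m, h1, rfl | h⟩
    · exact Or.inl h1
    · exact Or.inr ⟨m, h1, h⟩
  · rintro (h | ⟨m, h1, h⟩)
    · exact ⟨n, h, Or.inl rfl⟩
    · exact ⟨m, h1, Or.inr h⟩
lemma has3_loop (n : ℕ) (H : Position) : chain 3 ∈ loop n ::ₘ H ↔ chain 3 ∈ H := by simp
lemma has3_chain (n : ℕ) (H : Position) : chain 3 ∈ chain n ::ₘ H ↔ n = 3 ∨ chain 3 ∈ H := by
  simp [eq_comm]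

lemma eq_zero_iff' (G : Position) : G = 0 ↔ ¬ HasL G ∧ ¬ HasD G ∧ chain 3 ∉ G := by
  constructor
  · rintro rfl; simp [HasL, HasD]
  · rintro ⟨h1, h2, h3⟩
    apply Multiset.eq_zero_of_forall_notMem
    rintro (n | n) h
    · by_cases h4 : n = 3
      · subst h4; exact h3 h
      · exact h2 ⟨n, h4, h⟩
    · exact h1 ⟨n, h⟩

open Classical in
lemma tb_eq (G : Position) : tb G =
    if HasD G then 4 else if chain 3 ∈ G then (if HasL G then 6 else 4)
    else if HasL G then 8 else 0 := by
  have e0 := eq_zero_iff' G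
  have e1 : (∀ C ∈ G, C.isLoop = true) ↔ ¬ HasD G ∧ chain 3 ∉ G := by
    constructor
    · intro h
      refine ⟨?_, fun h3 => ?_⟩
      · rintro ⟨n, _, hn⟩
        simpa [isLoop] using h _ hn
      · simpa [isLoop] using h _ h3
    · rintro ⟨h1, h2⟩ (n | n) h
      · by_cases h4 : n = 3
        · subst h4; exact absurd h h2
        · exact absurd ⟨n, h4, h⟩ h1
      · rfl
  have e2 : (∃ C ∈ G, C.isLoop = true) ↔ HasL G := by
    constructor
    · rintro ⟨n | n, h, h'⟩
      · simp [isLoop] at h'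
      · exact ⟨n, h⟩
    · rintro ⟨n, h⟩; exact ⟨_, h, rfl⟩
  have e3 : (∀ C ∈ G, C.isChain = true → C = chain 3) ↔ ¬ HasD G := by
    constructor
    · rintro h ⟨n, h1, h2⟩
      have := h _ h2 rfl
      simp at this; exact h1 this
    · rintro h1 (n | n) h h'
      · by_cases h4 : n = 3
        · subst h4; rfl
        · exact absurd ⟨n, h4, h⟩ h1
      · simp [isChain] at h'
  unfold tb
  simp only [e0, e1, e2, e3]
  by_cases a : HasL G <;> by_cases b : HasD G <;> by_cases c : chain 3 ∈ G <;> simp [a, b, c]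

lemma size_cons (C : Component) (H : Position) :
    DotsAndBoxes.size (C ::ₘ H) = C.size + DotsAndBoxes.size H := by
  simp [DotsAndBoxes.size]

lemma size_chain (n : ℕ) (H : Position) :
    DotsAndBoxes.size (chain n ::ₘ H) = n + DotsAndBoxes.size H := size_cons _ _
lemma size_loop (n : ℕ) (H : Position) :
    DotsAndBoxes.size (loop n ::ₘ H) = n + DotsAndBoxes.size H := size_cons _ _

lemma cval_chain (n : ℕ) (H : Position) :
    cval (chain n ::ₘ H) = n - 4 + cval H + tb (chain n ::ₘ H) - tb H := by
  have h1 : numChains (chain n ::ₘ H) = numChains H + 1 := by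
    unfold numChains
    rw [Multiset.filter_cons_of_pos (p := fun C : Component => C.isChain = true) _ rfl, Multiset.card_cons]
  have h2 : numLoops (chain n ::ₘ H) = numLoops H := by
    unfold numLoops
    rw [Multiset.filter_cons_of_neg _ (by simp [isLoop])]
  unfold cval
  rw [size_chain, h1, h2]
  push_cast; ring

lemma cval_loop (n : ℕ) (H : Position) :
    cval (loop n ::ₘ H) = n - 8 + cval H + tb (loop n ::ₘ H) - tb H := by
  have h1 : numLoops (loop n ::ₘ H) = numLoops H + 1 := by
    unfold numLoops
    rw [Multiset.filter_cons_of_pos (p := fun C : Component => C.isLoop = true) _ rfl, Multiset.card_cons]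
  have h2 : numChains (loop n ::ₘ H) = numChains H := by
    unfold numChains
    rw [Multiset.filter_cons_of_neg _ (by simp [isChain])]
  unfold cval
  rw [size_loop, h1, h2]
  push_cast; ring

lemma openVal_chain (n : ℕ) (w : ℤ) : openVal (chain n) w = n - 2 + |w - 2| := rfl
lemma openVal_loop (n : ℕ) (w : ℤ) : openVal (loop n) w = n - 4 + |w - 4| := rfl

lemma value_zero : value 0 = 0 := by simp [value, valueAux]

lemma value_set {G : Position} (h : G ≠ 0) :
    value G = sInf { x : ℤ | ∃ C ∈ G, x = openVal C (value (G.erase C)) } := by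
  have hc : 0 < Multiset.card G := Multiset.card_pos.2 h
  obtain ⟨k, hk⟩ : ∃ k, Multiset.card G = k + 1 := ⟨Multiset.card G - 1, by omega⟩
  unfold value
  rw [hk]
  simp only [valueAux, h, if_false]
  congr 1
  ext x
  constructor <;>
  · rintro ⟨C, hC, hx⟩
    have e : Multiset.card (G.erase C) = k := by
      rw [Multiset.card_erase_of_mem hC, hk]; rfl
    refine ⟨C, hC, ?_⟩
    first
    | rw [e]; exact hx
    | rw [e] at hx; exact hx

lemma value_set_finite (G : Position) :
    { x : ℤ | ∃ C ∈ G, x = openVal C (value (G.erase C)) }.Finite := by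
  have : { x : ℤ | ∃ C ∈ G, x = openVal C (value (G.erase C)) } =
      Set.image (fun C => openVal C (value (G.erase C))) (G.toFinset : Set Component) := by
    ext x; simp [eq_comm]
  rw [this]
  exact (Finset.finite_toSet _).image _

lemma value_le (C : Component) (H : Position) : value (C ::ₘ H) ≤ openVal C (value H) := by
  rw [value_set (Multiset.cons_ne_zero)]
  apply csInf_le (value_set_finite _).bddBelow
  exact ⟨C, by simp, by simp⟩

lemma value_attain {G : Position} (h : G ≠ 0) :
    ∃ C H, G = C ::ₘ H ∧ value G = openVal C (value H) := by
  have hne : { x : ℤ | ∃ C ∈ G, x = openVal C (value (G.erase C)) }.Nonempty := by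
    obtain ⟨C, hC⟩ := Multiset.exists_mem_of_ne_zero h
    exact ⟨_, C, hC, rfl⟩
  obtain ⟨C, hC, hx⟩ := Int.csInf_mem hne (value_set_finite G).bddBelow
  exact ⟨C, G.erase C, (Multiset.cons_erase hC).symm, by rw [value_set h]; exact hx⟩

lemma valid_cons {C : Component} {H : Position} (h : Position.Valid (C ::ₘ H)) :
    C.Valid ∧ H.Valid :=
  ⟨h C (by simp), fun D hD => h D (by simp [hD])⟩

lemma valid_chain {n : ℕ} (h : (chain n).Valid) : 3 ≤ n := h
lemma valid_loop {n : ℕ} (h : (loop n).Valid) : 4 ≤ n ∧ n % 2 = 0 :=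
  ⟨h.1, Nat.even_iff.1 h.2⟩

/-- Case analysis on the optimal move. -/
lemma value_cases (G : Position) (hG : G.Valid) : G = 0 ∨
    (∃ (n : ℕ) (H : Position), G = chain n ::ₘ H ∧ 3 ≤ n ∧ H.Valid ∧ value G = n - 2 + |value H - 2|) ∨
    (∃ (n : ℕ) (H : Position), G = loop n ::ₘ H ∧ 4 ≤ n ∧ n % 2 = 0 ∧ H.Valid ∧
      value G = n - 4 + |value H - 4|) := by
  by_cases h : G = 0
  · exact Or.inl h
  obtain ⟨C, H, e, hv⟩ := value_attain h
  right
  obtain ⟨h1, h2⟩ := valid_cons (e ▸ hG)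
  rcases C with n | n
  · exact Or.inl ⟨n, H, e, h1, h2, hv⟩
  · exact Or.inr ⟨n, H, e, (valid_loop h1).1, (valid_loop h1).2, h2, hv⟩

lemma value_nonneg (G : Position) (hG : G.Valid) : 0 ≤ value G := by
  rcases value_cases G hG with rfl | ⟨n, H, -, h1, -, hv⟩ | ⟨n, H, -, h1, -, -, hv⟩
  · simp [value_zero]
  · have := abs_nonneg (value H - 2); omega
  · have := abs_nonneg (value H - 4); omega

lemma card_lt (C : Component) (H : Position) :
    Multiset.card H < Multiset.card (C ::ₘ H) := by simp

/-- Parity. -/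
lemma value_parity (G : Position) (hG : G.Valid) :
    (value G - DotsAndBoxes.size G) % 2 = 0 := by
  rcases value_cases G hG with rfl | ⟨n, H, e, h1, h2, hv⟩ | ⟨n, H, e, h1, h3, h2, hv⟩
  · simp [value_zero, DotsAndBoxes.size]
  · have ih := value_parity H h2
    rw [hv, e, size_chain]
    rcases abs_cases (value H - 2) with h | h <;> push_cast <;> omega
  · have ih := value_parity H h2
    rw [hv, e, size_loop]
    rcases abs_cases (value H - 4) with h | h <;> push_cast <;> omega
termination_by Multiset.card G
decreasing_by all_goals (rw [e]; simp)

/-- Positions with only 3-chains have value at most 3. -/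
lemma value_threes (G : Position) (hG : G.Valid) (hL : ¬ HasL G) (hD : ¬ HasD G) :
    value G ≤ 3 := by
  by_cases h3 : chain 3 ∈ G
  · obtain ⟨H, e⟩ := Multiset.exists_cons_of_mem h3
    rw [e, hasL_chain] at hL
    rw [e, hasD_chain] at hD
    have hH := (valid_cons (e ▸ hG)).2
    have ih := value_threes H hH hL (by tauto)
    have := value_le (chain 3) H
    have := value_nonneg H hH
    rw [e]
    rw [openVal_chain] at *
    rcases abs_cases (value H - 2) with h | h <;> push_cast at * <;> omega
  · rw [(eq_zero_iff' G).2 ⟨hL, hD, h3⟩, value_zero]; norm_num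
termination_by Multiset.card G
decreasing_by all_goals (rw [e]; simp)

lemma cval_zero : cval 0 = 0 := by simp [cval, tb, DotsAndBoxes.size, numChains, numLoops]

/-- The controlled value is a lower bound. -/
lemma cval_le_value (G : Position) (hG : G.Valid) : cval G ≤ value G := by
  classical
  rcases value_cases G hG with rfl | ⟨n, H, e, h1, h2, hv⟩ | ⟨n, H, e, h1, h3, h2, hv⟩
  · simp [value_zero, cval_zero]
  · have ih := cval_le_value H h2
    rw [hv, e, cval_chain, tb_eq, tb_eq H]
    by_cases h0 : H = 0
    · have := (eq_zero_iff' H).1 h0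
      subst h0
      simp only [cval_zero, value_zero, hasD_chain, hasL_chain, has3_chain, this]
      norm_num
      split_ifs <;> omega
    · have := (eq_zero_iff' H).not.1 h0
      simp only [hasD_chain, hasL_chain, has3_chain]
      have := le_abs_self (value H - 2)
      split_ifs <;> first | omega | tauto
  · have ih := cval_le_value H h2
    rw [hv, e, cval_loop, tb_eq, tb_eq H]
    by_cases h0 : H = 0
    · have := (eq_zero_iff' H).1 h0
      subst h0
      simp only [cval_zero, value_zero, hasD_loop, hasL_loop, has3_loop, this]
      norm_num
    · have h0' := (eq_zero_iff' H).not.1 h0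
      simp only [hasD_loop, hasL_loop, has3_loop]
      have := le_abs_self (value H - 4)
      have := neg_le_abs (value H - 4)
      by_cases hL : HasL H
      · simp only [hL]; split_ifs <;> first | omega | tauto
      · by_cases hD : HasD H
        · simp only [hD, if_true]; omega
        · have h3' : chain 3 ∈ H := by tauto
          have h4 := value_threes H h2 hL hD
          have h5 : cval H ≤ 3 := by omega
          simp only [hD, hL, h3', if_true, if_false]
          omega
termination_by Multiset.card G
decreasing_by all_goals (rw [e]; simp)

lemma size_even (K : Position) : K.Valid → ¬ HasD K → chain 3 ∉ K →
    DotsAndBoxes.size K % 2 = 0 := by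
  induction K using Multiset.induction with
  | empty => intros; simp [DotsAndBoxes.size]
  | cons C K ihK =>
    intro hK hKD hK3
    obtain ⟨hC, hK'⟩ := valid_cons hK
    rcases C with m | m
    · rw [hasD_chain] at hKD
      rw [has3_chain] at hK3
      tauto
    · rw [hasD_loop] at hKD
      rw [has3_loop] at hK3
      have := ihK hK' hKD hK3
      have := valid_loop hC
      rw [size_loop]; omega

lemma two_le_value (G : Position) (hG : G.Valid) (h0 : G ≠ 0) (h3 : chain 3 ∉ G)
    (h4 : loop 4 ∉ G) : 2 ≤ value G := by
  rcases value_cases G hG with rfl | ⟨n, H, e, h1, h2, hv⟩ | ⟨n, H, e, h1, hn, h2, hv⟩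
  · exact absurd rfl h0
  · have : n ≠ 3 := by rintro rfl; exact h3 (by rw [e]; simp)
    have := abs_nonneg (value H - 2)
    omega
  · have : n ≠ 4 := by rintro rfl; exact h4 (by rw [e]; simp)
    have := abs_nonneg (value H - 4)
    omega

lemma tb_le_cval (G : Position) : G.Valid → chain 3 ∉ G → loop 4 ∉ G → loop 6 ∉ G →
    tb G ≤ cval G := by
  induction G using Multiset.induction with
  | empty => intros; rw [cval_zero]; simp [tb]
  | cons C H ih =>
    intro hG h3 h4 h6
    obtain ⟨hC, hH⟩ := valid_cons hG
    have := ih hH (fun h => h3 (by simp [h])) (fun h => h4 (by simp [h]))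
      (fun h => h6 (by simp [h]))
    rcases C with n | n
    · have hn := valid_chain hC
      have : n ≠ 3 := by rintro rfl; exact h3 (by simp)
      rw [cval_chain]; omega
    · have hn := valid_loop hC
      have : n ≠ 4 := by rintro rfl; exact h4 (by simp)
      have : n ≠ 6 := by rintro rfl; exact h6 (by simp)
      rw [cval_loop]; omega

lemma four_le_tb (G : Position) (h0 : G ≠ 0) : 4 ≤ tb G := by
  have := (eq_zero_iff' G).not.1 h0
  rw [tb_eq]
  split_ifs <;> first | omega | tauto

lemma tb_loop (n : ℕ) (H : Position) (h : HasL H ∨ HasD H) : tb (loop n ::ₘ H) = tb H := by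
  classical
  rw [tb_eq, tb_eq H]
  simp only [hasD_loop, hasL_loop, has3_loop]
  by_cases a : HasL H <;> by_cases b : HasD H <;> by_cases c : chain 3 ∈ H <;>
    simp [a, b, c] <;> tauto

lemma hasLD (H : Position) (h0 : H ≠ 0) (h3 : chain 3 ∉ H) : HasL H ∨ HasD H := by
  have := (eq_zero_iff' H).not.1 h0
  tauto

lemma cval_loop' (n : ℕ) (H : Position) (h : HasL H ∨ HasD H) :
    cval (loop n ::ₘ H) = n - 8 + cval H := by
  rw [cval_loop, tb_loop n H h]; ring

lemma cval_one_loop (n : ℕ) : cval (loop n ::ₘ 0) = n := by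
  classical
  rw [cval_loop, cval_zero, tb_eq, tb_eq 0]
  simp only [hasD_loop, hasD_zero, hasL_zero, hasL_loop, has3_loop]
  simp

lemma cval_one_chain (n : ℕ) : cval (chain n ::ₘ 0) = n := by
  rw [cval_chain, cval_zero, tb_eq, tb_eq 0]
  simp only [hasD_chain, hasL_chain, has3_chain, hasD_zero, hasL_zero]
  by_cases h : n = 3 <;> simp [h]

/-- Opening a loop, when there are no 3-chains or the rest has a loop. -/
lemma loop_step (n : ℕ) (H : Position) (h : HasL H ∨ HasD H)
    (ih : value H ≤ 4 ∨ value H ≤ cval H)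
    (hw : 4 ≤ value H) (hn : n ≤ 8 ∨ 4 ≤ cval H) : value (loop n ::ₘ H) ≤ 4 ∨
      value (loop n ::ₘ H) ≤ cval (loop n ::ₘ H) := by
  have h1 := value_le (loop n) H
  rw [openVal_loop, abs_of_nonneg (by omega)] at h1
  rw [cval_loop' n H h]
  omega

/-- The value is at most the controlled value, or at most 4. -/
lemma value_le_max (G : Position) (hG : G.Valid) : value G ≤ 4 ∨ value G ≤ cval G := by
  classical
  by_cases h3 : chain 3 ∈ G
  · obtain ⟨H, e⟩ := Multiset.exists_cons_of_mem h3
    have hH := (valid_cons (e ▸ hG)).2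
    have ih := value_le_max H hH
    have h1 := value_le (chain 3) H
    have h0 := value_nonneg H hH
    rw [openVal_chain, ← e] at h1
    push_cast at h1
    by_cases hw : value H ≤ 4
    · left
      rcases abs_cases (value H - 2) with h | h <;> omega
    have ih' : value H ≤ cval H := by omega
    rw [abs_of_nonneg (by omega)] at h1
    have hc := cval_chain 3 H
    rw [← e] at hc
    push_cast at hc
    by_cases htb : tb H ≤ tb G
    · right; omega
    · have htb' := tb_eq G
      have htb'' := tb_eq H
      have hb : HasL H ∧ ¬ HasD H ∧ chain 3 ∉ H := by
        rw [e, tb_eq H, tb_eq (chain 3 ::ₘ H)] at htb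
        simp only [hasD_chain, hasL_chain, has3_chain] at htb
        by_cases a : HasL H <;> by_cases b : HasD H <;> by_cases c : chain 3 ∈ H <;>
          simp [a, b, c] at htb ⊢
      obtain ⟨hL, hD, hn3⟩ := hb
      have t1 : tb G = 6 := by
        rw [e, tb_eq]; simp [hasD_chain, hasL_chain, hL, hD]
      have t2 : tb H = 8 := by
        rw [tb_eq]; simp [hL, hD, hn3]
      have hpar : cval H % 2 = 0 := by
        have p := value_parity H hH
        have := size_even H hH hD hn3
        unfold cval
        omega
      have key : ∃ n, loop n ∈ H ∧ (n = 4 ∨ loop 4 ∉ H ∧ (n = 6 ∨ loop 6 ∉ H)) := by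
        by_cases k4 : loop 4 ∈ H
        · exact ⟨4, k4, Or.inl rfl⟩
        · by_cases k6 : loop 6 ∈ H
          · exact ⟨6, k6, Or.inr ⟨k4, Or.inl rfl⟩⟩
          · obtain ⟨n, hn⟩ := hL
            exact ⟨n, hn, Or.inr ⟨k4, Or.inr k6⟩⟩
      obtain ⟨n, hn, hcase⟩ := key
      obtain ⟨K, eK⟩ := Multiset.exists_cons_of_mem hn
      have e' : G = loop n ::ₘ (chain 3 ::ₘ K) := by
        rw [e, eK, Multiset.cons_swap]
      have hKv := (valid_cons (e' ▸ hG)).2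
      have hnv := valid_loop (valid_cons (e' ▸ hG)).1
      have ih2 := value_le_max (chain 3 ::ₘ K) hKv
      have hlow := cval_le_value (chain 3 ::ₘ K) hKv
      have h00 := value_nonneg _ hKv
      by_cases hKL : HasL K
      · have hKL' : HasL (chain 3 ::ₘ K) := by rw [hasL_chain]; exact hKL
        have hcG := cval_loop' n (chain 3 ::ₘ K) (Or.inl hKL')
        rw [← e'] at hcG
        have h2 := value_le (loop n) (chain 3 ::ₘ K)
        rw [openVal_loop, ← e'] at h2
        rcases hcase with rfl | ⟨k4, rfl | k6⟩
        · rcases abs_cases (value (chain 3 ::ₘ K) - 4) with h | h <;> push_cast at * <;> omega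
        · rcases abs_cases (value (chain 3 ::ₘ K) - 4) with h | h <;> push_cast at * <;> omega
        · have hK3 : chain 3 ∉ K := by rw [eK, has3_loop] at hn3; exact hn3
          have hKD : ¬ HasD K := by rw [eK, hasD_loop] at hD; exact hD
          have q1 := tb_le_cval K (valid_cons hKv).2 hK3
            (fun h => k4 (by rw [eK]; simp [h])) (fun h => k6 (by rw [eK]; simp [h]))
          have q2 := cval_chain 3 K
          have q3 : tb (chain 3 ::ₘ K) = 6 := by
            rw [tb_eq]; simp [hasD_chain, hasL_chain, hKL, hKD]
          rcases abs_cases (value (chain 3 ::ₘ K) - 4) with h | h <;> push_cast at * <;> omega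
      · have hK0 : K = 0 := by
          rw [eq_zero_iff']
          rw [eK, hasD_loop] at hD
          rw [eK, has3_loop] at hn3
          exact ⟨hKL, hD, hn3⟩
        subst hK0
        have h2 := value_le (loop n) (chain 3 ::ₘ 0)
        rw [openVal_loop, ← e'] at h2
        have h3 := value_le (chain 3) 0
        rw [openVal_chain, value_zero] at h3
        rw [cval_one_chain] at hlow
        norm_num at h3 hlow
        have q : value (chain 3 ::ₘ 0) = 3 := le_antisymm h3 hlow
        rw [show (chain 3 ::ₘ 0 : Position) = {chain 3} from rfl] at *
        rw [q] at h2
        norm_num at h2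
        have q1 := cval_one_loop n
        rw [← eK] at q1
        right
        omega
  · by_cases h4 : loop 4 ∈ G
    · obtain ⟨H, e⟩ := Multiset.exists_cons_of_mem h4
      have hH := (valid_cons (e ▸ hG)).2
      have ih := value_le_max H hH
      have h1 := value_le (loop 4) H
      have h0 := value_nonneg H hH
      rw [openVal_loop, ← e] at h1
      by_cases hz : H = 0
      · subst hz
        rw [value_zero] at h1
        norm_num at h1
        exact Or.inl h1
      · have h3' : chain 3 ∉ H := fun h => h3 (by rw [e]; simp [h])
        have hc := cval_loop' 4 H (hasLD H hz h3')
        rw [← e] at hc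
        rcases abs_cases (value H - 4) with h | h <;> push_cast at * <;> omega
    · by_cases h6 : loop 6 ∈ G
      · obtain ⟨H, e⟩ := Multiset.exists_cons_of_mem h6
        have hH := (valid_cons (e ▸ hG)).2
        have ih := value_le_max H hH
        have h1 := value_le (loop 6) H
        rw [openVal_loop, ← e] at h1
        by_cases hz : H = 0
        · subst hz
          rw [value_zero] at h1
          norm_num at h1
          rw [e, cval_one_loop, ← e]
          exact Or.inr h1
        · have h3' : chain 3 ∉ H := fun h => h3 (by rw [e]; simp [h])
          have h4' : loop 4 ∉ H := fun h => h4 (by rw [e]; simp [h])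
          have h0 := two_le_value H hH hz h3' h4'
          have hc := cval_loop' 6 H (hasLD H hz h3')
          rw [← e] at hc
          rcases abs_cases (value H - 4) with h | h <;> push_cast at * <;> omega
      · by_cases hL : HasL G
        · obtain ⟨n, hn⟩ := hL
          obtain ⟨H, e⟩ := Multiset.exists_cons_of_mem hn
          have hH := (valid_cons (e ▸ hG)).2
          have ih := value_le_max H hH
          by_cases hz : H = 0
          · subst hz
            have h1 := value_le (loop n) 0
            rw [openVal_loop, value_zero] at h1
            norm_num at h1
            rw [e, cval_one_loop]
            exact Or.inr h1
          · have h3' : chain 3 ∉ H := fun h => h3 (by rw [e]; simp [h])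
            have h4' : loop 4 ∉ H := fun h => h4 (by rw [e]; simp [h])
            have h6' : loop 6 ∉ H := fun h => h6 (by rw [e]; simp [h])
            have q1 := tb_le_cval H hH h3' h4' h6'
            have q2 := four_le_tb H hz
            have q3 := cval_le_value H hH
            rw [e]
            exact loop_step n H (hasLD H hz h3') ih (by omega) (Or.inr (by omega))
        · by_cases hz0 : G = 0
          · subst hz0; left; simp [value_zero]
          have hD : HasD G := by
            have := hasLD G hz0 h3; tauto
          obtain ⟨n, hn3, hn⟩ := hD
          obtain ⟨H, e⟩ := Multiset.exists_cons_of_mem hn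
          have hH := (valid_cons (e ▸ hG)).2
          have ih := value_le_max H hH
          have h1 := value_le (chain n) H
          rw [openVal_chain, ← e] at h1
          by_cases hz : H = 0
          · subst hz
            rw [value_zero] at h1
            norm_num at h1
            right
            rw [e, cval_one_chain, ← e]
            exact h1
          · have h3' : chain 3 ∉ H := fun h => h3 (by rw [e]; simp [h])
            have h4' : loop 4 ∉ H := fun h => h4 (by rw [e]; simp [h])
            have h6' : loop 6 ∉ H := fun h => h6 (by rw [e]; simp [h])
            have q1 := tb_le_cval H hH h3' h4' h6'
            have q2 := four_le_tb H hz
            have q3 := cval_le_value H hH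
            have hc := cval_chain n H
            have hL' : ¬ HasL H := by rw [e, hasL_chain] at hL; exact hL
            have hDH : HasD H := by have := hasLD H hz h3'; tauto
            have t1 : tb H = 4 := by rw [tb_eq]; simp [hDH]
            have t2 : tb (chain n ::ₘ H) = 4 := by rw [tb_eq]; simp [hasD_chain, hDH]
            rw [← e] at hc t2
            rw [abs_of_nonneg (by omega)] at h1
            right
            omega
termination_by Multiset.card G
decreasing_by
  all_goals first | (rw [e]; simp; done) | (rw [e']; simp; done)

lemma cval_mod_four (G : Position) (h3 : chain 3 ∉ G) :
    (cval G - DotsAndBoxes.size G) % 4 = 0 := by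
  have : tb G % 4 = 0 := by
    rw [tb_eq]; simp only [h3, if_false]; split_ifs <;> rfl
  unfold cval
  omega

/-- Without 3-chains and of even size, the value agrees with the size modulo 4. -/
lemma value_mod_four (G : Position) (hG : G.Valid) (h3 : chain 3 ∉ G)
    (hs : DotsAndBoxes.size G % 2 = 0) : (value G - DotsAndBoxes.size G) % 4 = 0 := by
  have hcv := cval_le_value G hG
  have hmx := value_le_max G hG
  have hcm := cval_mod_four G h3
  rcases value_cases G hG with hz | ⟨n, H, e, h1, h2, hv⟩ | ⟨n, H, e, h1, hn, h2, hv⟩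
  · subst hz; simp [value_zero, DotsAndBoxes.size]
  · have h3' : chain 3 ∉ H := fun h => h3 (by rw [e]; simp [h])
    have hsz : DotsAndBoxes.size G = n + DotsAndBoxes.size H := by rw [e, size_chain]
    have hn3 : n ≠ 3 := by rintro rfl; exact h3 (by rw [e]; simp)
    by_cases hev : n % 2 = 0
    · have ih := value_mod_four H h2 h3' (by omega)
      rcases abs_cases (value H - 2) with h | h <;> omega
    · have hp := value_parity H h2
      have hp' := value_parity G hG
      have habs : 1 ≤ |value H - 2| := by
        rcases abs_cases (value H - 2) with h | h <;> omega
      by_contra hbad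
      have hv4 : value G = 4 := by omega
      have hcc : cval G ≤ 2 := by omega
      have hDG : HasD G := ⟨n, hn3, by rw [e]; simp⟩
      by_cases h4 : loop 4 ∈ G
      · obtain ⟨K, eK⟩ := Multiset.exists_cons_of_mem h4
        have hK := (valid_cons (eK ▸ hG)).2
        have hK3 : chain 3 ∉ K := fun h => h3 (by rw [eK]; simp [h])
        have hKs : DotsAndBoxes.size G = 4 + DotsAndBoxes.size K := by rw [eK, size_loop]
        have hKD : HasD K := by rw [eK, hasD_loop] at hDG; exact hDG
        have ih := value_mod_four K hK hK3 (by omega)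
        have hc := cval_loop' 4 K (Or.inr hKD)
        have hle := value_le (loop 4) K
        rw [openVal_loop] at hle
        rw [← eK] at hc hle
        have := value_nonneg K hK
        have := value_le_max K hK
        rcases abs_cases (value K - 4) with h | h <;> push_cast at * <;> omega
      · by_cases h6 : loop 6 ∈ G
        · obtain ⟨K, eK⟩ := Multiset.exists_cons_of_mem h6
          have hK := (valid_cons (eK ▸ hG)).2
          have hK3 : chain 3 ∉ K := fun h => h3 (by rw [eK]; simp [h])
          have hK4 : loop 4 ∉ K := fun h => h4 (by rw [eK]; simp [h])
          have hKs : DotsAndBoxes.size G = 6 + DotsAndBoxes.size K := by rw [eK, size_loop]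
          have hKD : HasD K := by rw [eK, hasD_loop] at hDG; exact hDG
          have hK0 : K ≠ 0 := by rintro rfl; exact hasD_zero hKD
          have ih := value_mod_four K hK hK3 (by omega)
          have hc := cval_loop' 6 K (Or.inr hKD)
          have hle := value_le (loop 6) K
          rw [openVal_loop] at hle
          rw [← eK] at hc hle
          have := two_le_value K hK hK0 hK3 hK4
          have := value_le_max K hK
          rcases abs_cases (value K - 4) with h | h <;> push_cast at * <;> omega
        · have q1 := tb_le_cval G hG h3 h4 h6
          have q2 := four_le_tb G (by rintro rfl; exact hasD_zero hDG)
          omega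
  · have h3' : chain 3 ∉ H := fun h => h3 (by rw [e]; simp [h])
    have hsz : DotsAndBoxes.size G = n + DotsAndBoxes.size H := by rw [e, size_loop]
    have ih := value_mod_four H h2 h3' (by omega)
    rcases abs_cases (value H - 4) with h | h <;> omega
termination_by Multiset.card G
decreasing_by
  all_goals first | (rw [e]; simp; done) | (rw [eK]; simp; done)

/-- Removing a 3-chain changes the controlled value by at most 3. -/
lemma cval_three (H : Position) : cval H ≤ cval (chain 3 ::ₘ H) + 3 ∧
    (chain 3 ∈ H → cval H = cval (chain 3 ::ₘ H) + 1) := by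
  classical
  have hc := cval_chain 3 H
  have ht : tb H ≤ tb (chain 3 ::ₘ H) + 2 ∧ (chain 3 ∈ H → tb H = tb (chain 3 ::ₘ H)) := by
    rw [tb_eq, tb_eq (chain 3 ::ₘ H)]
    simp only [hasD_chain, hasL_chain, has3_chain]
    by_cases a : HasL H <;> by_cases b : HasD H <;> by_cases c : chain 3 ∈ H <;>
      simp [a, b, c]
  push_cast at hc
  refine ⟨by omega, fun h => ?_⟩
  have := ht.2 h
  omega

lemma cval_parity (G : Position) : (cval G - DotsAndBoxes.size G) % 2 = 0 := by
  have : tb G % 2 = 0 := by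
    rw [tb_eq]; split_ifs <;> rfl
  unfold cval
  omega

/-- A position with a 3-chain and small controlled value does not have value 0. -/
lemma value_ne_zero (H : Position) (hG : Position.Valid (chain 3 ::ₘ H))
    (hc : cval (chain 3 ::ₘ H) < -1) : value (chain 3 ::ₘ H) ≠ 0 := by
  classical
  intro h0
  have hm : chain 3 ∈ chain 3 ::ₘ H := by simp
  generalize hGe : chain 3 ::ₘ H = G at *
  rcases value_cases G hG with hz | ⟨n, K, e, h1, h2, hv⟩ | ⟨n, K, e, h1, hn, h2, hv⟩
  · subst hz; simp at hm
  · have := abs_nonneg (value K - 2); omega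
  · have hn4 : n = 4 := by have := abs_nonneg (value K - 4); omega
    subst hn4
    have hK4 : value K = 4 := by
      rcases abs_cases (value K - 4) with h | h <;> push_cast at hv <;> omega
    rw [e, has3_loop] at hm
    obtain ⟨M, eM⟩ := Multiset.exists_cons_of_mem hm
    have hM := (valid_cons (eM ▸ h2)).2
    have hle := value_le (chain 3) M
    rw [openVal_chain, ← eM, hK4] at hle
    have hM0 := value_nonneg M hM
    have hM5 : 5 ≤ value M := by
      rcases abs_cases (value M - 2) with h | h <;> push_cast at hle <;> omega
    have hMm := value_le_max M hM
    have hp := value_parity K h2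
    have hpc := cval_parity G
    have hs : DotsAndBoxes.size G = 4 + DotsAndBoxes.size K := by rw [e, size_loop]
    have c1 := cval_loop 4 K
    have c2 := cval_chain 3 M
    rw [← e] at c1
    rw [← eM] at c2
    have hsM : DotsAndBoxes.size K = 3 + DotsAndBoxes.size M := by rw [eM, size_chain]
    have hodd : ¬ (¬ HasD M ∧ chain 3 ∉ M) := by
      rintro ⟨q1, q2⟩
      have := size_even M hM q1 q2
      omega
    have ht : tb M ≤ tb G := by
      rw [tb_eq, tb_eq G, e, eM]
      simp only [hasD_loop, has3_loop, hasL_loop, hasD_chain, hasL_chain, has3_chain]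
      by_cases a : HasL M <;> by_cases b : HasD M <;> by_cases c : chain 3 ∈ M <;>
        simp [a, b, c] at hodd ⊢
    push_cast at c1 c2
    omega

end Aux

/-- Second example of 3-optimality: if c(G) < −1 and either θ(G) ≥ 2, or θ(G) = 1
and size(G) ≢ 3 mod 4, then opening a 3-chain is optimal and v(G) = 1 or 2 by parity. -/
theorem three_optimality_two (G : Position) (hG : G.Valid) (hc : cval G < -1)
    (hth : 2 ≤ theta G ∨ (theta G = 1 ∧ size G % 4 ≠ 3)) :
    Optimal G (Component.chain 3) ∧
    (Odd (size G) → value G = 1) ∧ (Even (size G) → value G = 2) := by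
  have hmem : Component.chain 3 ∈ G := by
    rw [← Multiset.count_pos]
    change 0 < theta G
    omega
  obtain ⟨H, e⟩ := Multiset.exists_cons_of_mem hmem
  have hH : Position.Valid H := (valid_cons (e ▸ hG)).2
  have hth2 : theta G = theta H + 1 := by
    rw [e]; unfold theta; rw [Multiset.count_cons_self]
  have hsz : size G = 3 + size H := by rw [e, size_chain]
  have herase : G.erase (Component.chain 3) = H := by rw [e]; simp
  have hle := value_le (Component.chain 3) H
  have hopen : valueOpen G (Component.chain 3) = 1 + |value H - 2| := by
    unfold valueOpen
    rw [herase, openVal_chain]; norm_num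
  rw [openVal_chain, ← e] at hle
  push_cast at hle
  have hcH := cval_three H
  rw [← e] at hcH
  have hpG := value_parity G hG
  have hpH := value_parity H hH
  have hnG := value_nonneg G hG
  have hnH := value_nonneg H hH
  have hmH := value_le_max H hH
  have hH4 : value H ≤ 4 := by omega
  have hpc := cval_parity G
  have hne : value G ≠ 0 := by
    have := value_ne_zero H (e ▸ hG) (e ▸ hc)
    rw [e]; exact this
  suffices hmain : value G = 1 + |value H - 2| ∧ (size G % 2 = 1 → value G = 1) ∧
      (size G % 2 = 0 → value G = 2) by
    refine ⟨⟨hmem, ?_⟩, ?_, ?_⟩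
    · rw [hopen, hmain.1]
    · intro h; exact hmain.2.1 (Nat.odd_iff.1 h)
    · intro h; exact hmain.2.2 (Nat.even_iff.1 h)
  rcases Nat.mod_two_eq_zero_or_one (size G) with hpar | hpar
  · rcases abs_cases (value H - 2) with h | h <;> omega
  · have hH2 : value H = 2 := by
      by_cases h3 : Component.chain 3 ∈ H
      · have hcH' := hcH.2 h3
        obtain ⟨K, eK⟩ := Multiset.exists_cons_of_mem h3
        have hK : Position.Valid K := (valid_cons (eK ▸ hH)).2
        have hne' : value H ≠ 0 := by
          have := value_ne_zero K (eK ▸ hH) (by rw [← eK]; omega)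
          rw [eK]; exact this
        have hleK := value_le (Component.chain 3) K
        rw [openVal_chain, ← eK] at hleK
        push_cast at hleK
        have hcK := cval_three K
        rw [← eK] at hcK
        have := value_le_max K hK
        have := value_nonneg K hK
        rcases abs_cases (value K - 2) with h | h <;> omega
      · have ht0 : theta H = 0 := Multiset.count_eq_zero.2 h3
        have := value_mod_four H hH h3 (by omega)
        omega
    rw [hH2] at hle ⊢
    norm_num at hle ⊢
    omega

end DotsAndBoxes
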